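/- arXiv:1504.01907 — 3 statements merged into one kernel-verified Lean document; each statement's English description precedes it below -/
import Mathlib

section
/- Let n ≥ 1, let f : ℝ → ℝⁿ be a function, let ν ∈ ℝⁿ with ‖ν‖ ≤ 1, and let a, b, u_b, v_b ∈ ℝ. Let J = [min{u_b, v_b}, max{u_b, v_b}] and let M ≥ 0 be such that ‖f(s) − f(r)‖ ≤ M for all s, r ∈ J. Assume sgn(a − u_b)·((f(a) − f(u_b))·ν) ≥ 0 and sgn(b − v_b)·((f(b) − f(v_b))·ν) ≥ 0. Then (1/2)·(sgn(v_b − a) − sgn(u_b − b))·((f(a) − f(b))·ν) ≤ M. (The case analysis (Cases I and II) in the proof of Theorem 4.3, with a = tr u, b = tr v.) -/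
open Set

/-- The case analysis (Cases I and II) in the proof of Theorem 4.3:
given the boundary entropy inequalities for traces `a`, `b` with boundary data
`u_b`, `v_b`, the combined boundary term is bounded by the oscillation `M` of
`f` on the interval `J` between the boundary data. -/
theorem boundary_case_analysis
    (n : ℕ) (hn : 1 ≤ n)
    (f : ℝ → EuclideanSpace ℝ (Fin n))
    (ν : EuclideanSpace ℝ (Fin n)) (hν : ‖ν‖ ≤ 1)
    (a b u_b v_b : ℝ)
    (M : ℝ) (hM : 0 ≤ M)
    (hMJ : ∀ s ∈ Set.Icc (min u_b v_b) (max u_b v_b),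
           ∀ r ∈ Set.Icc (min u_b v_b) (max u_b v_b), ‖f s - f r‖ ≤ M)
    (ha : Real.sign (a - u_b) * (inner ℝ (f a - f u_b) ν : ℝ) ≥ 0)
    (hb : Real.sign (b - v_b) * (inner ℝ (f b - f v_b) ν : ℝ) ≥ 0) :
    (1 / 2) * (Real.sign (v_b - a) - Real.sign (u_b - b))
      * (inner ℝ (f a - f b) ν : ℝ) ≤ M := by
  have key : ∀ s ∈ Set.Icc (min u_b v_b) (max u_b v_b),
      ∀ r ∈ Set.Icc (min u_b v_b) (max u_b v_b),
      (inner ℝ (f s) ν : ℝ) - inner ℝ (f r) ν ≤ M := by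
    intro s hs r hr
    rw [← inner_sub_left]
    have h1 := real_inner_le_norm (f s - f r) ν
    have h2 := hMJ s hs r hr
    have h3 := mul_le_mul h2 hν (norm_nonneg ν) hM
    linarith
  rw [inner_sub_left] at ha hb ⊢
  generalize hg : (fun x => (inner ℝ (f x) ν : ℝ)) = g at *
  have hg' : ∀ x, (inner ℝ (f x) ν : ℝ) = g x := fun x => by rw [← hg]
  simp only [hg'] at *
  have hu : u_b ∈ Set.Icc (min u_b v_b) (max u_b v_b) := by simp
  have hv : v_b ∈ Set.Icc (min u_b v_b) (max u_b v_b) := by simp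
  have lo : ∀ x w : ℝ, Real.sign (x - w) * (g x - g w) ≥ 0 → x ≤ w → g x ≤ g w := by
    intro x w h hx
    rcases hx.lt_or_eq with hx | rfl
    · rw [Real.sign_of_neg (by linarith)] at h
      linarith
    · exact le_rfl
  have up : ∀ x w : ℝ, Real.sign (x - w) * (g x - g w) ≥ 0 → w ≤ x → g w ≤ g x := by
    intro x w h hx
    rcases hx.lt_or_eq with hx | rfl
    · rw [Real.sign_of_pos (by linarith)] at h
      linarith
    · exact le_rfl
  have mem : ∀ x, (u_b ≤ x ∧ x ≤ v_b) ∨ (v_b ≤ x ∧ x ≤ u_b) →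
      x ∈ Set.Icc (min u_b v_b) (max u_b v_b) := by
    intro x hx
    simp only [Set.mem_Icc, min_le_iff, le_max_iff]
    tauto
  have C1 : a ≤ v_b → u_b ≤ b → g a - g b ≤ M := by
    intro h1 h2
    obtain ⟨p, hp, hp'⟩ : ∃ p ∈ Set.Icc (min u_b v_b) (max u_b v_b), g a ≤ g p := by
      rcases le_total a u_b with h | h
      · exact ⟨u_b, hu, lo _ _ ha h⟩
      · exact ⟨a, mem a (Or.inl ⟨h, h1⟩), le_rfl⟩
    obtain ⟨q, hq, hq'⟩ : ∃ q ∈ Set.Icc (min u_b v_b) (max u_b v_b), g q ≤ g b := by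
      rcases le_total v_b b with h | h
      · exact ⟨v_b, hv, up _ _ hb h⟩
      · exact ⟨b, mem b (Or.inl ⟨h2, h⟩), le_rfl⟩
    have := key p hp q hq
    linarith
  have C2 : v_b ≤ a → b ≤ u_b → g b - g a ≤ M := by
    intro h1 h2
    obtain ⟨p, hp, hp'⟩ : ∃ p ∈ Set.Icc (min u_b v_b) (max u_b v_b), g p ≤ g a := by
      rcases le_total u_b a with h | h
      · exact ⟨u_b, hu, up _ _ ha h⟩
      · exact ⟨a, mem a (Or.inr ⟨h1, h⟩), le_rfl⟩
    obtain ⟨q, hq, hq'⟩ : ∃ q ∈ Set.Icc (min u_b v_b) (max u_b v_b), g b ≤ g q := by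
      rcases le_total b v_b with h | h
      · exact ⟨v_b, hv, lo _ _ hb h⟩
      · exact ⟨b, mem b (Or.inr ⟨h, h2⟩), le_rfl⟩
    have := key q hq p hp
    linarith
  have S1 : (v_b < a ∧ Real.sign (v_b - a) = -1) ∨ (v_b = a ∧ Real.sign (v_b - a) = 0) ∨
      (a < v_b ∧ Real.sign (v_b - a) = 1) := by
    rcases lt_trichotomy v_b a with h | h | h
    · exact Or.inl ⟨h, Real.sign_of_neg (by linarith)⟩
    · exact Or.inr (Or.inl ⟨h, by simp [h]⟩)
    · exact Or.inr (Or.inr ⟨h, Real.sign_of_pos (by linarith)⟩)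
  have S2 : (u_b < b ∧ Real.sign (u_b - b) = -1) ∨ (u_b = b ∧ Real.sign (u_b - b) = 0) ∨
      (b < u_b ∧ Real.sign (u_b - b) = 1) := by
    rcases lt_trichotomy u_b b with h | h | h
    · exact Or.inl ⟨h, Real.sign_of_neg (by linarith)⟩
    · exact Or.inr (Or.inl ⟨h, by simp [h]⟩)
    · exact Or.inr (Or.inr ⟨h, Real.sign_of_pos (by linarith)⟩)
  rcases S1 with ⟨h1, e1⟩ | ⟨h1, e1⟩ | ⟨h1, e1⟩ <;>
  rcases S2 with ⟨h2, e2⟩ | ⟨h2, e2⟩ | ⟨h2, e2⟩ <;>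
  rw [e1, e2] <;>
  first
  | linarith
  | linarith [C1 (by linarith) (by linarith)]
  | linarith [C2 (by linarith) (by linarith)]
end

section
/- Let n ≥ 1, let f : ℝ → ℝⁿ be Lipschitz continuous with constant L_f ≥ 0, let ν ∈ ℝⁿ with ‖ν‖ ≤ 1, and let a, b, u_b, v_b ∈ ℝ. Assume that for every k ∈ ℝ: (sgn(a − k) − sgn(u_b − k))·((f(a) − f(k))·ν) ≥ 0 and (sgn(b − k) − sgn(v_b − k))·((f(b) − f(k))·ν) ≥ 0. Then −sgn(a − b)·((f(a) − f(b))·ν) ≤ L_f·|u_b − v_b|. (The key pointwise boundary estimate in the proof of Theorem 4.3: the two hypotheses are the boundary entropy inequalities (6) for two solutions with traces a, b and boundary data u_b, v_b.) -/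
open Set

/-- Lower-side consequence of the boundary entropy inequality. -/
lemma entropy_left (g : ℝ → ℝ) (a u : ℝ)
    (h : ∀ k, (Real.sign (a - k) - Real.sign (u - k)) * (g a - g k) ≥ 0)
    (k : ℝ) (h1 : u ≤ k) (h2 : k ≤ a) : g k ≤ g a := by
  rcases h2.eq_or_lt with rfl | h2
  · exact le_rfl
  have h := h k
  rw [Real.sign_of_pos (sub_pos.2 h2)] at h
  rcases h1.eq_or_lt with rfl | h1
  · rw [sub_self, Real.sign_zero] at h
    linarith
  · rw [Real.sign_of_neg (sub_neg.2 h1)] at h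
    linarith

/-- Upper-side consequence of the boundary entropy inequality. -/
lemma entropy_right (g : ℝ → ℝ) (a u : ℝ)
    (h : ∀ k, (Real.sign (a - k) - Real.sign (u - k)) * (g a - g k) ≥ 0)
    (k : ℝ) (h1 : a ≤ k) (h2 : k ≤ u) : g a ≤ g k := by
  rcases h1.eq_or_lt with rfl | h1
  · exact le_rfl
  have h := h k
  rw [Real.sign_of_neg (sub_neg.2 h1)] at h
  rcases h2.eq_or_lt with rfl | h2
  · rw [sub_self, Real.sign_zero] at h
    linarith
  · rw [Real.sign_of_pos (sub_pos.2 h2)] at h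
    linarith

/-- The estimate when `b < a`, for a scalar flux. -/
lemma scalar_estimate (g : ℝ → ℝ) (L : ℝ) (hL : 0 ≤ L)
    (hg : ∀ s r, g s - g r ≤ L * |s - r|) (a b u v : ℝ) (hab : b < a)
    (ha : ∀ k, (Real.sign (a - k) - Real.sign (u - k)) * (g a - g k) ≥ 0)
    (hb : ∀ k, (Real.sign (b - k) - Real.sign (v - k)) * (g b - g k) ≥ 0) :
    g b - g a ≤ L * |u - v| := by
  have A := entropy_left g a u ha
  have B := entropy_right g b v hb
  have h0 : 0 ≤ L * |u - v| := by positivity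
  rcases le_or_gt u b with h1 | h1
  · linarith [A b h1 hab.le]
  rcases le_or_gt a v with h2 | h2
  · linarith [B a hab.le h2]
  have key : ∀ p q : ℝ, g p ≤ g a → g b ≤ g q → |q - p| ≤ |u - v| → g b - g a ≤ L * |u - v| := by
    intro p q hp hq hpq
    have := mul_le_mul_of_nonneg_left hpq hL
    linarith [hg q p]
  rcases le_total u a with h | h <;> rcases le_total b v with h' | h'
  · exact key u v (A u le_rfl h) (B v h' le_rfl) (abs_sub_comm v u).le
  · refine key u b (A u le_rfl h) le_rfl ?_
    rw [abs_of_nonpos (by linarith), abs_of_nonneg (by linarith)]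
    linarith
  · refine key a v le_rfl (B v h' le_rfl) ?_
    rw [abs_of_nonpos (by linarith), abs_of_nonneg (by linarith)]
    linarith
  · refine key a b le_rfl le_rfl ?_
    rw [abs_of_nonpos (by linarith), abs_of_nonneg (by linarith)]
    linarith

/-- The key pointwise boundary estimate in the proof of Theorem 4.3:
if the traces `a`, `b` satisfy the boundary entropy inequalities (6) with
boundary data `u_b`, `v_b`, then the Kružkov boundary term is controlled by
`L_f · |u_b − v_b|`. -/
theorem pointwise_boundary_estimate
    (n : ℕ) (hn : 1 ≤ n)
    (f : ℝ → EuclideanSpace ℝ (Fin n))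
    (L_f : ℝ) (hLf : 0 ≤ L_f)
    (hf : ∀ s r : ℝ, ‖f s - f r‖ ≤ L_f * |s - r|)
    (ν : EuclideanSpace ℝ (Fin n)) (hν : ‖ν‖ ≤ 1)
    (a b u_b v_b : ℝ)
    (ha : ∀ k : ℝ, (Real.sign (a - k) - Real.sign (u_b - k))
            * (inner ℝ (f a - f k) ν : ℝ) ≥ 0)
    (hb : ∀ k : ℝ, (Real.sign (b - k) - Real.sign (v_b - k))
            * (inner ℝ (f b - f k) ν : ℝ) ≥ 0) :
    -(Real.sign (a - b) * (inner ℝ (f a - f b) ν : ℝ)) ≤ L_f * |u_b - v_b| := by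
  have hg : ∀ s r, inner ℝ (f s) ν - inner ℝ (f r) ν ≤ L_f * |s - r| := by
    intro s r
    rw [← inner_sub_left]
    calc inner ℝ (f s - f r) ν ≤ ‖f s - f r‖ * ‖ν‖ := real_inner_le_norm _ _
      _ ≤ ‖f s - f r‖ * 1 := by gcongr
      _ ≤ L_f * |s - r| := by rw [mul_one]; exact hf s r
  simp only [inner_sub_left] at ha hb ⊢
  rcases lt_trichotomy a b with h | rfl | h
  · have := scalar_estimate (fun s => inner ℝ (f s) ν) L_f hLf hg b a v_b u_b h hb ha
    rw [abs_sub_comm] at this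
    rw [Real.sign_of_neg (sub_neg.2 h)]
    linarith
  · simp only [sub_self, mul_zero, neg_zero]
    positivity
  · have := scalar_estimate (fun s => inner ℝ (f s) ν) L_f hLf hg a b u_b v_b h ha hb
    rw [Real.sign_of_pos (sub_pos.2 h)]
    linarith
end

section
/- Let n ≥ 1, let Ω ⊆ ℝⁿ be a nonempty bounded open set, T > 0, ε > 0. Let f : [0,T] × closure(Ω) × ℝ → ℝⁿ and F : [0,T] × closure(Ω) × ℝ → ℝ be of class C², and let c₁, c₂ be constants with c₁ ≥ 1 + sup |∂_w(div_x f)(t,x,w)| + sup |∂_w F(t,x,w)| (suprema over (t,x,w) ∈ [0,T] × closure(Ω) × ℝ, assumed finite) and c₂ ≥ sup_{(t,x) ∈ [0,T]×closure(Ω)} |div_x f(t,x,0)| + sup_{(t,x)} |F(t,x,0)|. Let u : [0,T] × closure(Ω) → ℝ be continuous, once continuously differentiable in t and twice continuously differentiable in x on (0,T) × Ω, and satisfy, for all (t,x) ∈ (0,T) × Ω, ∂_t u(t,x) + (div_x f)(t,x,u(t,x)) + ∂_w f(t,x,u(t,x))·∇_x u(t,x) = F(t,x,u(t,x)) + ε·Δu(t,x).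 Then for every t ∈ [0,T] and every (τ,x) ∈ [0,t] × Ω: |u(τ,x)| ≤ (M_o + M_b)·e^{c₁ t} + (c₂/c₁)·(e^{c₁ t} − 1), where M_o = sup_{x ∈ Ω} |u(0,x)| and M_b = sup_{(τ,ξ) ∈ [0,t] × ∂Ω} |u(τ,ξ)|. (Lemma 3.2: the ε-uniform L∞ estimate for the parabolic approximation.) -/
open MeasureTheory Set Filter

/-- The divergence of a vector field `g : ℝⁿ → ℝⁿ` at `x`. -/
noncomputable def divX (n : ℕ)
    (g : EuclideanSpace ℝ (Fin n) → EuclideanSpace ℝ (Fin n))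
    (x : EuclideanSpace ℝ (Fin n)) : ℝ :=
  ∑ i : Fin n, fderiv ℝ (fun y => g y i) x (EuclideanSpace.single i 1)

/-- The Laplacian of a scalar field `u : ℝⁿ → ℝ` at `x`. -/
noncomputable def lap (n : ℕ)
    (u : EuclideanSpace ℝ (Fin n) → ℝ)
    (x : EuclideanSpace ℝ (Fin n)) : ℝ :=
  ∑ i : Fin n,
    fderiv ℝ (fun y => fderiv ℝ u y (EuclideanSpace.single i 1)) x
      (EuclideanSpace.single i 1)

open Topology in
lemma aux_second_deriv {g : ℝ → ℝ} (hmax : IsLocalMax g 0) (hc : ContinuousAt g 0) :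
    deriv (deriv g) 0 ≤ 0 := by
  by_contra! h
  have h0 : deriv g 0 = 0 := hmax.deriv_eq_zero
  have hmin := isLocalMin_of_deriv_deriv_pos h h0 hc
  have hconst : g =ᶠ[𝓝 0] fun _ => g 0 := by
    filter_upwards [hmax, hmin] with y h1 h2
    exact le_antisymm h1 h2
  have : deriv (deriv g) 0 = 0 := by
    rw [hconst.deriv.deriv_eq]
    simp
  linarith

open Topology in
lemma aux_lap (n : ℕ) {u : EuclideanSpace ℝ (Fin n) → ℝ} {Ω : Set (EuclideanSpace ℝ (Fin n))}
    (hΩ : IsOpen Ω) (hu : ContDiffOn ℝ 2 u Ω) {x : EuclideanSpace ℝ (Fin n)} (hx : x ∈ Ω)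
    (hmax : IsLocalMax u x) : lap n u x ≤ 0 := by
  unfold lap
  refine Finset.sum_nonpos fun i _ => ?_
  set e : EuclideanSpace ℝ (Fin n) := EuclideanSpace.single i 1
  have hl : ∀ s : ℝ, HasDerivAt (fun s : ℝ => x + s • e) e s := by
    intro s
    simpa using ((hasDerivAt_id s).smul_const e).const_add x
  have hlc : Continuous (fun s : ℝ => x + s • e) := by fun_prop
  have hl0 : Tendsto (fun s : ℝ => x + s • e) (𝓝 0) (𝓝 x) := by
    have := hlc.tendsto 0
    simpa using this
  have hux : ContDiffAt ℝ 2 u x := hu.contDiffAt (hΩ.mem_nhds hx)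
  have hder : ∀ᶠ s : ℝ in 𝓝 0, deriv (fun s : ℝ => u (x + s • e)) s = fderiv ℝ u (x + s • e) e := by
    filter_upwards [hl0.eventually (hΩ.mem_nhds hx)] with s hs
    have h1 : DifferentiableAt ℝ u (x + s • e) :=
      (hu.contDiffAt (hΩ.mem_nhds hs)).differentiableAt (by norm_num)
    exact (h1.hasFDerivAt.comp_hasDerivAt s (hl s)).deriv
  have hd : DifferentiableAt ℝ (fun y => fderiv ℝ u y e) x := by
    have : DifferentiableAt ℝ (fderiv ℝ u) x :=
      (hux.fderiv_right (m := 1) (by norm_num)).differentiableAt (by norm_num)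
    exact this.clm_apply (differentiableAt_const e)
  have key : deriv (deriv (fun s : ℝ => u (x + s • e))) 0
      = fderiv ℝ (fun y => fderiv ℝ u y e) x e := by
    rw [Filter.EventuallyEq.deriv_eq hder]
    have h2 : HasFDerivAt (fun y => fderiv ℝ u y e) (fderiv ℝ (fun y => fderiv ℝ u y e) x)
        (x + (0:ℝ) • e) := by simpa using hd.hasFDerivAt
    exact (h2.comp_hasDerivAt (0:ℝ) (hl 0)).deriv
  rw [← key]
  apply aux_second_deriv
  · have := hl0.eventually hmax
    simpa [IsLocalMax, IsMaxFilter] using this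
  · have h3 : ContinuousAt u (x + (0:ℝ) • e) := by simpa using hux.continuousAt
    exact ContinuousAt.comp (f := fun s : ℝ => x + s • e) h3 hlc.continuousAt

open Topology in
lemma aux_max (n : ℕ) (Ω : Set (EuclideanSpace ℝ (Fin n)))
    (hΩo : IsOpen Ω) (hΩb : Bornology.IsBounded Ω)
    (T c₁ c₂ K s : ℝ) (hc₁ : 1 ≤ c₁) (hc₂ : 0 ≤ c₂) (hK : 0 ≤ K) (hsT : s < T)
    (u : ℝ → EuclideanSpace ℝ (Fin n) → ℝ)
    (hu_cont : ContinuousOn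
        (fun p : ℝ × EuclideanSpace ℝ (Fin n) => u p.1 p.2)
        (Set.Icc 0 T ×ˢ closure Ω))
    (hu_t : ∀ x ∈ Ω, ContDiffOn ℝ 1 (fun τ => u τ x) (Set.Ioo 0 T))
    (hu_x : ∀ t ∈ Set.Ioo 0 T, ContDiffOn ℝ 2 (u t) Ω)
    (hpde : ∀ t ∈ Set.Ioo 0 T, ∀ x ∈ Ω, fderiv ℝ (u t) x = 0 → lap n (u t) x ≤ 0 → 0 < u t x →
        deriv (fun τ => u τ x) t ≤ (c₁ - 1) * u t x + c₂)
    (h0 : ∀ x ∈ Ω, u 0 x ≤ K)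
    (hb : ∀ τ ∈ Set.Icc 0 s, ∀ x ∈ frontier Ω, u τ x ≤ K) :
    ∀ τ ∈ Set.Icc 0 s, ∀ x ∈ Ω,
      u τ x ≤ K * Real.exp (c₁ * τ) + c₂ / c₁ * (Real.exp (c₁ * τ) - 1) := by
  intro τ hτ x hx
  have hd : 0 ≤ c₂ / c₁ := by positivity
  set d := c₂ / c₁ with hdd
  have hdc : c₁ * d = c₂ := by rw [hdd]; field_simp
  let z : ℝ × EuclideanSpace ℝ (Fin n) → ℝ := fun p => Real.exp (-(c₁ * p.1)) * (u p.1 p.2 + d)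
  have hcomp : IsCompact (Set.Icc 0 s ×ˢ closure Ω) := isCompact_Icc.prod hΩb.isCompact_closure
  have hzc : ContinuousOn z (Set.Icc 0 s ×ˢ closure Ω) := by
    have h1 : ContinuousOn (fun p : ℝ × EuclideanSpace ℝ (Fin n) => u p.1 p.2)
        (Set.Icc 0 s ×ˢ closure Ω) :=
      hu_cont.mono (Set.prod_mono (Set.Icc_subset_Icc le_rfl hsT.le) le_rfl)
    have h2 : Continuous (fun p : ℝ × EuclideanSpace ℝ (Fin n) => Real.exp (-(c₁ * p.1))) := by
      fun_prop
    exact h2.continuousOn.mul (h1.add continuousOn_const)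
  obtain ⟨⟨t0, x0⟩, ⟨ht0, hx0⟩, hmax⟩ :=
    hcomp.exists_isMaxOn ⟨(τ, x), hτ, subset_closure hx⟩ hzc
  simp only at ht0 hx0
  suffices hz : z (t0, x0) ≤ K + d by
    have h1 : z (τ, x) ≤ K + d := (hmax ⟨hτ, subset_closure hx⟩).trans hz
    have h2 : Real.exp (c₁ * τ) * z (τ, x) ≤ Real.exp (c₁ * τ) * (K + d) := by gcongr
    have h3 : Real.exp (c₁ * τ) * z (τ, x) = u τ x + d := by
      simp only [z]
      rw [← mul_assoc, ← Real.exp_add]; simp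
    rw [h3] at h2
    linarith
  have hE : Real.exp (-(c₁ * t0)) ≤ 1 := by
    rw [Real.exp_le_one_iff]
    have := ht0.1
    have : 0 ≤ c₁ * t0 := by positivity
    linarith
  have hE0 := Real.exp_pos (-(c₁ * t0))
  have triv : u t0 x0 ≤ K → z (t0, x0) ≤ K + d := by
    intro h
    simp only [z]
    nlinarith
  by_cases hxf : x0 ∈ Ω
  swap
  · exact triv (hb t0 ht0 x0 (by rw [hΩo.frontier_eq]; exact ⟨hx0, hxf⟩))
  rcases eq_or_lt_of_le ht0.1 with h | ht0p
  · subst h; exact triv (h0 x0 hxf)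
  by_cases hupos : 0 < u t0 x0
  swap
  · exact triv (by linarith)
  exfalso
  have htT : t0 ∈ Set.Ioo 0 T := ⟨ht0p, ht0.2.trans_lt hsT⟩
  have hlm : IsLocalMax (u t0) x0 := by
    filter_upwards [hΩo.mem_nhds hxf] with y hy
    have h1 : z (t0, y) ≤ z (t0, x0) := hmax ⟨ht0, subset_closure hy⟩
    simp only [z] at h1
    have := le_of_mul_le_mul_left h1 hE0
    linarith
  have hP := hpde t0 htT x0 hxf hlm.fderiv_eq_zero
    (aux_lap n hΩo (hu_x t0 htT) hxf hlm) hupos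
  have hdu : HasDerivAt (fun τ => u τ x0) (deriv (fun τ => u τ x0) t0) t0 :=
    (((hu_t x0 hxf).contDiffAt (isOpen_Ioo.mem_nhds htT)).differentiableAt
      (by norm_num)).hasDerivAt
  set D := deriv (fun τ => u τ x0) t0
  have hdz : HasDerivAt (fun τ => z (τ, x0))
      (Real.exp (-(c₁ * t0)) * (-c₁) * (u t0 x0 + d) + Real.exp (-(c₁ * t0)) * D) t0 := by
    have h1 : HasDerivAt (fun τ : ℝ => -(c₁ * τ)) (-c₁) t0 := by
      simpa using ((hasDerivAt_id t0).const_mul c₁).fun_neg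
    exact h1.exp.mul (hdu.add_const d)
  have hnn : 0 ≤ Real.exp (-(c₁ * t0)) * (-c₁) * (u t0 x0 + d) + Real.exp (-(c₁ * t0)) * D := by
    have hs := (hdz.hasDerivWithinAt (s := Set.Iio t0))
    rw [hasDerivWithinAt_iff_tendsto_slope' (by simp)] at hs
    refine ge_of_tendsto hs ?_
    have : Set.Ioo 0 t0 ∈ 𝓝[<] t0 := Ioo_mem_nhdsLT ht0p
    filter_upwards [this] with r hr
    have h1 : z (r, x0) ≤ z (t0, x0) := hmax ⟨⟨hr.1.le, hr.2.le.trans ht0.2⟩, hx0⟩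
    rw [slope_def_field]
    exact div_nonneg_of_nonpos (by linarith) (by linarith [hr.2])
  have : 0 ≤ Real.exp (-(c₁ * t0)) * (D - c₁ * (u t0 x0 + d)) := by linarith
  have := nonneg_of_mul_nonneg_right this hE0
  nlinarith

open Topology in
lemma aux_max' (n : ℕ) (Ω : Set (EuclideanSpace ℝ (Fin n)))
    (hΩo : IsOpen Ω) (hΩb : Bornology.IsBounded Ω)
    (T c₁ c₂ K t : ℝ) (hT : 0 < T) (hc₁ : 1 ≤ c₁) (hc₂ : 0 ≤ c₂) (hK : 0 ≤ K) (htT : t ≤ T)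
    (u : ℝ → EuclideanSpace ℝ (Fin n) → ℝ)
    (hu_cont : ContinuousOn
        (fun p : ℝ × EuclideanSpace ℝ (Fin n) => u p.1 p.2)
        (Set.Icc 0 T ×ˢ closure Ω))
    (hu_t : ∀ x ∈ Ω, ContDiffOn ℝ 1 (fun τ => u τ x) (Set.Ioo 0 T))
    (hu_x : ∀ t ∈ Set.Ioo 0 T, ContDiffOn ℝ 2 (u t) Ω)
    (hpde : ∀ t ∈ Set.Ioo 0 T, ∀ x ∈ Ω, fderiv ℝ (u t) x = 0 → lap n (u t) x ≤ 0 → 0 < u t x →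
        deriv (fun τ => u τ x) t ≤ (c₁ - 1) * u t x + c₂)
    (h0 : ∀ x ∈ Ω, u 0 x ≤ K)
    (hb : ∀ τ ∈ Set.Icc 0 t, ∀ x ∈ frontier Ω, u τ x ≤ K) :
    ∀ τ ∈ Set.Icc 0 t, ∀ x ∈ Ω,
      u τ x ≤ K * Real.exp (c₁ * t) + c₂ / c₁ * (Real.exp (c₁ * t) - 1) := by
  intro τ hτ x hx
  have hd : 0 ≤ c₂ / c₁ := by positivity
  have main : ∀ r, r < T → r ∈ Set.Icc 0 t → 
      u r x ≤ K * Real.exp (c₁ * t) + c₂ / c₁ * (Real.exp (c₁ * t) - 1) := by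
    intro r hrT hr
    have h := aux_max n Ω hΩo hΩb T c₁ c₂ K r hc₁ hc₂ hK hrT u hu_cont hu_t hu_x hpde h0
      (fun τ hτ => hb τ ⟨hτ.1, hτ.2.trans hr.2⟩) r ⟨hr.1, le_rfl⟩ x hx
    refine h.trans ?_
    have := hr.2
    gcongr
  rcases lt_or_eq_of_le (hτ.2.trans htT) with h | h
  · exact main τ h hτ
  · have ht : t = T := le_antisymm htT (h ▸ hτ.2)
    subst ht
    subst h
    have hc : ContinuousOn (fun r => u r x) (Set.Icc 0 τ) :=
      hu_cont.comp (f := fun r : ℝ => (r, x)) (by fun_prop)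
        (fun r hr => ⟨hr, subset_closure hx⟩)
    have hc1 : Tendsto (fun r => u r x) (𝓝[<] τ) (𝓝 (u τ x)) := by
      have := (hc τ ⟨hT.le, le_rfl⟩).mono (Ioo_subset_Icc_self)
      have h2 : Tendsto (fun r => u r x) (𝓝[Set.Ioo 0 τ] τ) (𝓝 (u τ x)) := this
      rwa [nhdsWithin_Ioo_eq_nhdsLT hT] at h2
    refine le_of_tendsto hc1 ?_
    filter_upwards [Ioo_mem_nhdsLT hT] with r hr
    exact main r hr.2 ⟨hr.1.le, hr.2.le⟩

lemma aux_div (n : ℕ) (Ω : Set (EuclideanSpace ℝ (Fin n))) (hΩo : IsOpen Ω)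
    (g : EuclideanSpace ℝ (Fin n) → ℝ → EuclideanSpace ℝ (Fin n))
    (hg : ContDiffOn ℝ 2 (fun p : EuclideanSpace ℝ (Fin n) × ℝ => g p.1 p.2) (Ω ×ˢ Set.univ))
    (x : EuclideanSpace ℝ (Fin n)) (hx : x ∈ Ω) :
    Differentiable ℝ (fun v => divX n (fun y => g y v) x) := by
  intro w
  unfold divX
  refine DifferentiableAt.fun_sum fun i _ => ?_
  let φ : EuclideanSpace ℝ (Fin n) × ℝ → ℝ := fun p => g p.1 p.2 i
  have hat : ∀ v, ContDiffAt ℝ 2 φ (x, v) := by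
    intro v
    have h1 := hg.contDiffAt ((hΩo.prod isOpen_univ).mem_nhds (⟨hx, trivial⟩ : (x, v) ∈ Ω ×ˢ Set.univ))
    exact (contDiffAt_euclidean.1 h1) i
  have heq : (fun v => fderiv ℝ (fun y => g y v i) x (EuclideanSpace.single i 1))
      = fun v => fderiv ℝ φ (x, v) (EuclideanSpace.single i 1, 0) := by
    funext v
    have h1 : HasFDerivAt φ (fderiv ℝ φ (x, v)) (x, v) :=
      ((hat v).differentiableAt (by norm_num)).hasFDerivAt
    have h2 := HasFDerivAt.comp (f := fun y : EuclideanSpace ℝ (Fin n) => (y, v)) x h1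
      (hasFDerivAt_prodMk_left (𝕜 := ℝ) x v)
    have h3 : fderiv ℝ (fun y => g y v i) x = _ := h2.fderiv
    rw [h3]
    simp
  rw [heq]
  have h4 : DifferentiableAt ℝ (fderiv ℝ φ) (x, w) :=
      ((hat w).fderiv_right (m := 1) (by norm_num)).differentiableAt (by norm_num)
  have h5 : DifferentiableAt ℝ (fun v : ℝ => fderiv ℝ φ (x, v)) w :=
    h4.comp w (f := fun v : ℝ => (x, v)) (by fun_prop)
  exact h5.clm_apply (differentiableAt_const _)

/-- Lemma 3.2: the `ε`-uniform `L∞` estimate for classical solutions of the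
parabolic approximation
`∂ₜu + div_x f(t,x,u) + ∂_w f(t,x,u)·∇u = F(t,x,u) + ε Δu`. -/
theorem parabolic_Linfty_estimate
    (n : ℕ) (hn : 1 ≤ n)
    (Ω : Set (EuclideanSpace ℝ (Fin n))) (hΩne : Ω.Nonempty)
    (hΩo : IsOpen Ω) (hΩb : Bornology.IsBounded Ω)
    (T : ℝ) (hT : 0 < T) (ε : ℝ) (hε : 0 < ε)
    (f : ℝ → EuclideanSpace ℝ (Fin n) → ℝ → EuclideanSpace ℝ (Fin n))
    (F : ℝ → EuclideanSpace ℝ (Fin n) → ℝ → ℝ)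
    (hf : ContDiffOn ℝ 2
        (fun p : ℝ × EuclideanSpace ℝ (Fin n) × ℝ => f p.1 p.2.1 p.2.2)
        (Set.Icc 0 T ×ˢ closure Ω ×ˢ Set.univ))
    (hF : ContDiffOn ℝ 2
        (fun p : ℝ × EuclideanSpace ℝ (Fin n) × ℝ => F p.1 p.2.1 p.2.2)
        (Set.Icc 0 T ×ˢ closure Ω ×ˢ Set.univ))
    (c₁ c₂ : ℝ)
    (hc₁ : ∀ t ∈ Set.Icc 0 T, ∀ x ∈ closure Ω, ∀ w : ℝ,
           ∀ t' ∈ Set.Icc 0 T, ∀ x' ∈ closure Ω, ∀ w' : ℝ,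
           1 + |deriv (fun v => divX n (fun y => f t y v) x) w|
             + |deriv (fun v => F t' x' v) w'| ≤ c₁)
    (hc₂ : ∀ t ∈ Set.Icc 0 T, ∀ x ∈ closure Ω, ∀ t' ∈ Set.Icc 0 T, ∀ x' ∈ closure Ω,
           |divX n (fun y => f t y 0) x| + |F t' x' 0| ≤ c₂)
    (u : ℝ → EuclideanSpace ℝ (Fin n) → ℝ)
    (hu_cont : ContinuousOn
        (fun p : ℝ × EuclideanSpace ℝ (Fin n) => u p.1 p.2)
        (Set.Icc 0 T ×ˢ closure Ω))
    (hu_t : ∀ x ∈ Ω, ContDiffOn ℝ 1 (fun τ => u τ x) (Set.Ioo 0 T))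
    (hu_x : ∀ t ∈ Set.Ioo 0 T, ContDiffOn ℝ 2 (u t) Ω)
    (hpde : ∀ t ∈ Set.Ioo 0 T, ∀ x ∈ Ω,
        deriv (fun τ => u τ x) t
          + divX n (fun y => f t y (u t x)) x
          + (inner ℝ (deriv (fun w => f t x w) (u t x)) (gradient (u t) x) : ℝ)
        = F t x (u t x) + ε * lap n (u t) x) :
    ∀ t ∈ Set.Icc 0 T, ∀ τ ∈ Set.Icc 0 t, ∀ x ∈ Ω,
      |u τ x| ≤
        (sSup ((fun y => |u 0 y|) '' Ω)
          + sSup ((fun p : ℝ × EuclideanSpace ℝ (Fin n) => |u p.1 p.2|)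
                  '' (Set.Icc 0 t ×ˢ frontier Ω))) * Real.exp (c₁ * t)
        + c₂ / c₁ * (Real.exp (c₁ * t) - 1) := by
  intro t ht τ hτ x hx
  -- constants
  have h0T : (0:ℝ) ∈ Set.Icc 0 T := ⟨le_rfl, hT.le⟩
  have hxc := subset_closure hx
  have hc1 : 1 ≤ c₁ := by
    have := hc₁ 0 h0T x hxc 0 0 h0T x hxc 0
    have := abs_nonneg (deriv (fun v => divX n (fun y => f 0 y v) x) 0)
    have := abs_nonneg (deriv (fun v => F 0 x v) 0)
    linarith
  have hc2 : 0 ≤ c₂ := le_trans (by positivity) (hc₂ 0 h0T x hxc 0 h0T x hxc)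
  -- growth bound
  have hG : ∀ t ∈ Set.Ioo 0 T, ∀ x ∈ Ω, ∀ w : ℝ,
      |F t x w - divX n (fun y => f t y w) x| ≤ (c₁ - 1) * |w| + c₂ := by
    intro t ht x hx w
    have hti := Ioo_subset_Icc_self ht
    have hxi := subset_closure hx
    have hd1 : Differentiable ℝ (fun v => divX n (fun y => f t y v) x) := by
      apply aux_div n Ω hΩo (fun y v => f t y v) _ x hx
      exact hf.comp (f := fun p : EuclideanSpace ℝ (Fin n) × ℝ => (t, p.1, p.2))
        (by fun_prop) (fun p hp => ⟨hti, subset_closure hp.1, trivial⟩)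
    have hd2 : Differentiable ℝ (fun v => F t x v) := by
      have : ContDiffOn ℝ 2 (fun v => F t x v) Set.univ :=
        hF.comp (f := fun v : ℝ => (t, x, v))
          (by fun_prop) (fun p hp => ⟨hti, hxi, trivial⟩)
      exact (contDiffOn_univ.1 this).differentiable (by norm_num)
    have hmv := Convex.norm_image_sub_le_of_norm_deriv_le
      (f := fun v => F t x v - divX n (fun y => f t y v) x) (C := c₁ - 1) (s := Set.univ)
      (x := 0) (y := w) (fun v _ => (hd2 v).sub (hd1 v)) (fun v _ => by
        rw [deriv_fun_sub (hd2 v) (hd1 v), Real.norm_eq_abs]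
        have h1 := hc₁ t hti x hxi v t hti x hxi v
        have h2 := abs_sub (deriv (fun v => F t x v) v)
          (deriv (fun v => divX n (fun y => f t y v) x) v)
        linarith) convex_univ trivial trivial
    simp only [Real.norm_eq_abs, sub_zero] at hmv
    have h3 := hc₂ t hti x hxi t hti x hxi
    have h4 := abs_sub (F t x 0) (divX n (fun y => f t y 0) x)
    have h5 := abs_sub_abs_le_abs_sub (F t x w - divX n (fun y => f t y w) x)
      (F t x 0 - divX n (fun y => f t y 0) x)
    linarith
  -- suprema
  have hK := hΩb.isCompact_closure
  have habs : ContinuousOn (fun p : ℝ × EuclideanSpace ℝ (Fin n) => |u p.1 p.2|)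
      (Set.Icc 0 T ×ˢ closure Ω) := hu_cont.abs
  have hbdd := ((isCompact_Icc.prod hK).image_of_continuousOn habs).bddAbove
  have hb1 : BddAbove ((fun y => |u 0 y|) '' Ω) := by
    refine hbdd.mono ?_
    rintro _ ⟨y, hy, rfl⟩
    exact ⟨(0, y), ⟨h0T, subset_closure hy⟩, rfl⟩
  have hb2 : BddAbove ((fun p : ℝ × EuclideanSpace ℝ (Fin n) => |u p.1 p.2|)
                  '' (Set.Icc 0 t ×ˢ frontier Ω)) :=
    hbdd.mono (Set.image_mono (Set.prod_mono (Set.Icc_subset_Icc le_rfl ht.2)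
      frontier_subset_closure))
  set M1 := sSup ((fun y => |u 0 y|) '' Ω)
  set M2 := sSup ((fun p : ℝ × EuclideanSpace ℝ (Fin n) => |u p.1 p.2|)
                  '' (Set.Icc 0 t ×ˢ frontier Ω))
  have hM1 : 0 ≤ M1 := Real.sSup_nonneg (by rintro _ ⟨y, _, rfl⟩; exact abs_nonneg _)
  have hM2 : 0 ≤ M2 := Real.sSup_nonneg (by rintro _ ⟨y, _, rfl⟩; exact abs_nonneg _)
  have hi : ∀ y ∈ Ω, |u 0 y| ≤ M1 + M2 := fun y hy =>
    (le_csSup hb1 ⟨y, hy, rfl⟩).trans (by linarith)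
  have hbd : ∀ r ∈ Set.Icc 0 t, ∀ y ∈ frontier Ω, |u r y| ≤ M1 + M2 := fun r hr y hy =>
    (le_csSup hb2 ⟨(r, y), ⟨hr, hy⟩, rfl⟩).trans (by linarith)
  rw [abs_le']
  constructor
  · refine aux_max' n Ω hΩo hΩb T c₁ c₂ (M1 + M2) t hT hc1 hc2 (by linarith) ht.2 u
      hu_cont hu_t hu_x ?_ (fun y hy => (le_abs_self _).trans (hi y hy))
      (fun r hr y hy => (le_abs_self _).trans (hbd r hr y hy)) τ hτ x hx
    intro s hs y hy hgrad hlap hpos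
    have h1 := hpde s hs y hy
    have hg : gradient (u s) y = 0 := by simp [gradient, hgrad]
    rw [hg, inner_zero_right] at h1
    have h2 := (abs_le.1 (hG s hs y hy (u s y))).2
    rw [abs_of_pos hpos] at h2
    nlinarith
  · refine aux_max' n Ω hΩo hΩb T c₁ c₂ (M1 + M2) t hT hc1 hc2 (by linarith) ht.2
      (fun s y => - u s y)
      hu_cont.neg (fun y hy => (hu_t y hy).neg) (fun s hs => (hu_x s hs).neg) ?_
      (fun y hy => (neg_le_abs _).trans (hi y hy))
      (fun r hr y hy => (neg_le_abs _).trans (hbd r hr y hy)) τ hτ x hx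
    intro s hs y hy hgrad hlap hpos
    have h1 := hpde s hs y hy
    have hgrad' : fderiv ℝ (u s) y = 0 := by
      rw [fderiv_fun_neg] at hgrad
      exact neg_eq_zero.1 hgrad
    have hlap' : 0 ≤ lap n (u s) y := by
      have : lap n (fun y => - u s y) y = - lap n (u s) y := by
        simp [lap, fderiv_fun_neg]
      linarith
    have hg : gradient (u s) y = 0 := by simp [gradient, hgrad']
    rw [hg, inner_zero_right] at h1
    have h2 := (abs_le.1 (hG s hs y hy (u s y))).1
    rw [abs_of_neg (by linarith)] at h2
    rw [deriv.fun_neg]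
    nlinarith [mul_nonneg hε.le hlap']
end
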